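/- Let Y be a real Banach space and A : ℓ¹ → Y a bounded linear operator such that f(A e^{(k)}) → 0 as k → ∞ for every f ∈ Y* (i.e., A is weak*-to-weak continuous). Then for every real p > 1, every α > 0, and every y^δ ∈ Y, the Tikhonov functional T(x) = (1/p)‖A x − y^δ‖_Y^p + α ‖x‖_{ℓ¹} attains its infimum over ℓ¹: there exists x₀ ∈ ℓ¹ with T(x₀) ≤ T(x) for all x ∈ ℓ¹. -/

import Mathlib

open Filter Topology

/-- The `k`-th standard unit vector in `ℓ¹`. -/
noncomputable def stdUnit (k : ℕ) : lp (fun _ : ℕ => ℝ) 1 := lp.single 1 k 1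

theorem Ultrafilter.exists_tendsto_of_abs_le {ι : Type*} (l : Ultrafilter ι) {f : ι → ℝ} {C : ℝ}
    (h : ∀ i, |f i| ≤ C) : ∃ a, Tendsto f l (𝓝 a) := by
  obtain ⟨a, -, ha⟩ := (isCompact_Icc (a := -C) (b := C)).ultrafilter_le_nhds' (l.map f)
    (Filter.mem_map.2 (Filter.univ_mem' fun i => abs_le.1 (h i)))
  exact ⟨a, ha⟩

theorem hasSum_apply_stdUnit (g : lp (fun _ : ℕ => ℝ) 1 →L[ℝ] ℝ) (x : lp (fun _ : ℕ => ℝ) 1) :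
    HasSum (fun k => x k * g (stdUnit k)) (g x) := by
  have h := (lp.hasSum_single ENNReal.one_ne_top x).mapL g
  convert h using 2 with k
  have : lp.single (E := fun _ : ℕ => ℝ) 1 k (x k) = x k • stdUnit k := by
    rw [stdUnit, ← lp.single_smul, smul_eq_mul, mul_one]
  rw [this, map_smul, smul_eq_mul]

theorem hasSum_abs_coord (x : lp (fun _ : ℕ => ℝ) 1) : HasSum (fun k => |x k|) ‖x‖ := by
  simpa using lp.hasSum_norm (by simp) x

theorem abs_apply_sub_sum_le (g : lp (fun _ : ℕ => ℝ) 1 →L[ℝ] ℝ) {ε : ℝ} {N : ℕ} (hε : 0 ≤ ε)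
    (hN : ∀ k, N ≤ k → |g (stdUnit k)| ≤ ε) (x : lp (fun _ : ℕ => ℝ) 1) :
    |g x - ∑ k ∈ Finset.range N, x k * g (stdUnit k)| ≤ ε * ‖x‖ := by
  have htail := (hasSum_nat_add_iff' N).2 (hasSum_apply_stdUnit g x)
  have hnorm := (hasSum_nat_add_iff' N).2 (hasSum_abs_coord x)
  calc _ ≤ ε * (‖x‖ - ∑ k ∈ Finset.range N, |x k|) := by
        rw [← Real.norm_eq_abs]
        refine htail.norm_le_of_bounded (hnorm.mul_left ε) fun k => ?_
        rw [Real.norm_eq_abs, abs_mul, mul_comm]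
        exact mul_le_mul_of_nonneg_right (hN _ (Nat.le_add_left N k)) (abs_nonneg _)
    _ ≤ ε * ‖x‖ := mul_le_mul_of_nonneg_left
        (sub_le_self _ (Finset.sum_nonneg fun _ _ => abs_nonneg _)) hε

/-- A bounded functional on `ℓ¹` represented by a null sequence is continuous along bounded
families that converge coordinatewise. -/
theorem tendsto_apply_of_tendsto_coord {ι : Type*} {l : Filter ι}
    (g : lp (fun _ : ℕ => ℝ) 1 →L[ℝ] ℝ) (hg : Tendsto (fun k => g (stdUnit k)) atTop (𝓝 0))
    {u : ι → lp (fun _ : ℕ => ℝ) 1} {x : lp (fun _ : ℕ => ℝ) 1} {R : ℝ} (hu : ∀ i, ‖u i‖ ≤ R)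
    (hx : ∀ k, Tendsto (fun i => u i k) l (𝓝 (x k))) :
    Tendsto (fun i => g (u i)) l (𝓝 (g x)) := by
  rw [Metric.tendsto_nhds]
  intro δ hδ
  set M := |R| + ‖x‖ + 1 with hM
  have hM0 : 0 < M := by positivity
  obtain ⟨N, hN⟩ := Metric.tendsto_atTop.1 hg (δ / (2 * M)) (by positivity)
  have hN' : ∀ k, N ≤ k → |g (stdUnit k)| ≤ δ / (2 * M) := fun k hk => by
    simpa using (hN k hk).le
  have hsum : Tendsto (fun i => ∑ k ∈ Finset.range N, u i k * g (stdUnit k)) l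
      (𝓝 (∑ k ∈ Finset.range N, x k * g (stdUnit k))) :=
    tendsto_finsetSum _ fun k _ => (hx k).mul_const _
  filter_upwards [Metric.tendsto_nhds.1 hsum (δ / 2) (by positivity)] with i hi
  have hε : 0 ≤ δ / (2 * M) := by positivity
  have h1 := abs_apply_sub_sum_le g hε hN' (u i)
  have h2 := abs_apply_sub_sum_le g hε hN' x
  have h3 : δ / (2 * M) * ‖u i‖ + δ / (2 * M) * ‖x‖ ≤ δ / 2 := by
    calc _ = δ / (2 * M) * (‖u i‖ + ‖x‖) := by ring
      _ ≤ δ / (2 * M) * M := by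
        gcongr
        linarith [hu i, le_abs_self R]
      _ = δ / 2 := by field_simp
  rw [Real.dist_eq] at hi ⊢
  rw [abs_le] at h1 h2
  rw [abs_lt] at hi ⊢
  constructor <;> linarith

/-- Bounded families in `ℓ¹` have coordinatewise limits in `ℓ¹` along ultrafilters. -/
theorem exists_tendsto_coord {ι : Type*} (l : Ultrafilter ι) {u : ι → lp (fun _ : ℕ => ℝ) 1}
    {R : ℝ} (hu : ∀ i, ‖u i‖ ≤ R) :
    ∃ x : lp (fun _ : ℕ => ℝ) 1, ∀ k, Tendsto (fun i => u i k) l (𝓝 (x k)) := by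
  have h : ∀ k, ∃ a, Tendsto (fun i => u i k) l (𝓝 a) := fun k =>
    l.exists_tendsto_of_abs_le fun i => (lp.norm_apply_le_norm one_ne_zero (u i) k).trans (hu i)
  choose x hx using h
  have hbdd : Bornology.IsBounded (Set.range u) :=
    isBounded_iff_forall_norm_le.2 ⟨R, Set.forall_mem_range.2 hu⟩
  exact ⟨⟨x, lp.memℓp_of_tendsto (l := (l : Filter ι)) hbdd (tendsto_pi_nhds.2 hx)⟩, hx⟩

theorem norm_le_of_tendsto_dual {ι Y : Type*} [NormedAddCommGroup Y] [NormedSpace ℝ Y]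
    {l : Filter ι} [l.NeBot] {v : ι → Y} {y : Y} {a : ℝ}
    (hv : ∀ f : Y →L[ℝ] ℝ, Tendsto (fun i => f (v i)) l (𝓝 (f y)))
    (ha : Tendsto (fun i => ‖v i‖) l (𝓝 a)) : ‖y‖ ≤ a := by
  obtain ⟨f, hf, hfy⟩ := exists_dual_vector'' ℝ y
  have hfy' : f y = ‖y‖ := hfy
  rw [← hfy']
  refine le_of_tendsto_of_tendsto' (hv f) ha fun i => ?_
  calc f (v i) ≤ ‖f (v i)‖ := le_abs_self _
    _ ≤ ‖f‖ * ‖v i‖ := f.le_opNorm _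
    _ ≤ ‖v i‖ := mul_le_of_le_one_left (norm_nonneg _) hf

theorem norm_le_of_tendsto_coord {ι : Type*} {l : Filter ι} [l.NeBot]
    {u : ι → lp (fun _ : ℕ => ℝ) 1} {x : lp (fun _ : ℕ => ℝ) 1} {b : ℝ}
    (hx : ∀ k, Tendsto (fun i => u i k) l (𝓝 (x k)))
    (hb : Tendsto (fun i => ‖u i‖) l (𝓝 b)) : ‖x‖ ≤ b :=
  le_of_forall_gt_imp_ge_of_dense fun _ hC =>
    lp.norm_le_of_tendsto ((hb.eventually_lt_const hC).mono fun _ h => h.le)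
      (tendsto_pi_nhds.2 hx)

/-- if `A : ℓ¹ → Y` is a bounded linear operator with `f(A e^{(k)}) → 0`
for every `f ∈ Y*` (weak*-to-weak continuity), then for every `p > 1`, `α > 0` and
`y^δ ∈ Y` the Tikhonov functional `x ↦ (1/p)‖Ax − y^δ‖^p + α‖x‖` attains its infimum
over `ℓ¹`. -/
theorem stmt_13 {Y : Type*} [NormedAddCommGroup Y] [NormedSpace ℝ Y] [CompleteSpace Y]
    (A : lp (fun _ : ℕ => ℝ) 1 →L[ℝ] Y)
    (hweak : ∀ f : Y →L[ℝ] ℝ, Tendsto (fun k => f (A (stdUnit k))) atTop (nhds 0))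
    (p : ℝ) (hp : 1 < p) (α : ℝ) (hα : 0 < α) (yδ : Y) :
    ∃ x₀ : lp (fun _ : ℕ => ℝ) 1, ∀ x : lp (fun _ : ℕ => ℝ) 1,
      (1 / p) * ‖A x₀ - yδ‖ ^ p + α * ‖x₀‖ ≤ (1 / p) * ‖A x - yδ‖ ^ p + α * ‖x‖ := by
  set T : lp (fun _ : ℕ => ℝ) 1 → ℝ := fun x => (1 / p) * ‖A x - yδ‖ ^ p + α * ‖x‖ with hT
  have hp0 : 0 < p := by linarith
  have hres : ∀ x, 0 ≤ (1 / p) * ‖A x - yδ‖ ^ p := fun x => by positivity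
  have hbelow : BddBelow (Set.range T) :=
    ⟨0, Set.forall_mem_range.2 fun x => add_nonneg (hres x) (by positivity)⟩
  obtain ⟨t, -, ht, htmem⟩ := exists_seq_tendsto_sInf (Set.range_nonempty T) hbelow
  choose u hu using htmem
  obtain ⟨K, hK⟩ := ht.bddAbove_range
  have hnorm : ∀ n, ‖u n‖ ≤ K / α := fun n => by
    rw [le_div_iff₀ hα]
    have h1 : T (u n) ≤ K := (hu n).trans_le (hK (Set.mem_range_self n))
    have h2 := hres (u n)
    simp only [hT] at h1
    linarith
  have hAnorm : ∀ n, ‖A (u n) - yδ‖ ≤ ‖A‖ * (K / α) + ‖yδ‖ := fun n =>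
    (norm_sub_le _ _).trans (add_le_add_left (A.le_opNorm_of_le (hnorm n)) _)
  let l : Ultrafilter ℕ := hyperfilter ℕ
  obtain ⟨x₀, hx₀⟩ := exists_tendsto_coord l hnorm
  obtain ⟨a, ha⟩ := l.exists_tendsto_of_abs_le fun n => (abs_norm _).trans_le (hAnorm n)
  obtain ⟨b, hb⟩ := l.exists_tendsto_of_abs_le fun n => (abs_norm _).trans_le (hnorm n)
  have hxa : ‖A x₀ - yδ‖ ≤ a := norm_le_of_tendsto_dual (fun f => by
    simpa using (tendsto_apply_of_tendsto_coord (f.comp A) (hweak f) hnorm hx₀).sub_const (f yδ)) ha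
  have hxb : ‖x₀‖ ≤ b := norm_le_of_tendsto_coord hx₀ hb
  have hlim : Tendsto t l (𝓝 ((1 / p) * a ^ p + α * b)) := by
    rw [← funext hu]
    exact ((ha.rpow_const (Or.inr hp0.le)).const_mul _).add (hb.const_mul _)
  have hinf := tendsto_nhds_unique hlim (ht.mono_left Nat.hyperfilter_le_atTop)
  refine ⟨x₀, fun x => ?_⟩
  calc (1 / p) * ‖A x₀ - yδ‖ ^ p + α * ‖x₀‖ ≤ (1 / p) * a ^ p + α * b := by gcongr
    _ = sInf (Set.range T) := hinf
    _ ≤ T x := csInf_le hbelow (Set.mem_range_self x)
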